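/- In the one-period setting, for every s ∈ (inf supp_𝒫 S̲₁, sup supp_𝒫 S̄₁) and every P ∈ 𝒫, there exist Q ∈ Θ_P and λ ∈ (0,1) such that E^Q[(1−λ) S̲₁ + λ S̄₁] = s. -/

import Mathlib

open MeasureTheory Set
open scoped ENNReal

noncomputable section

/-- Convexity for a set of measures. -/
def ConvexMeasureSet {Ω : Type*} [MeasurableSpace Ω] (𝒬 : Set (Measure Ω)) : Prop :=
  ∀ P ∈ 𝒬, ∀ Q ∈ 𝒬, ∀ a b : ℝ≥0∞, a + b = 1 → a • P + b • Q ∈ 𝒬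

/-- `Θ_P`: the probability measures `R` with `P ≪ R ⋘ 𝒬` under which `f` is integrable. -/
def Theta {Ω : Type*} [MeasurableSpace Ω] (𝒬 : Set (Measure Ω)) (f : Ω → ℝ)
    (P : Measure Ω) : Set (Measure Ω) :=
  {R | IsProbabilityMeasure R ∧ P ≪ R ∧ (∃ P' ∈ 𝒬, R ≪ P') ∧ Integrable f R}

/-- The support of the distribution of `f` under the family `𝒬`: the smallest closed set of
full measure under every member of `𝒬`. -/
def rvSupport {Ω : Type*} [MeasurableSpace Ω] (𝒬 : Set (Measure Ω)) (f : Ω → ℝ) : Set ℝ :=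
  ⋂₀ {F : Set ℝ | IsClosed F ∧ ∀ P ∈ 𝒬, P (f ⁻¹' F) = 1}

/-- If `p < 0`, a convex combination of `u + b * p` and `v + b * q` is negative for some large `b`
and some weights, both positive. -/
theorem exists_weighted_combination_neg {p : ℝ} (hp : p < 0) (q u v : ℝ) :
    ∃ l ∈ Ioo (0 : ℝ) 1, ∃ b : ℝ, 0 ≤ b ∧ (1 - l) * (u + b * p) + l * (v + b * q) < 0 := by
  have hd : 0 < |q| - p := by linarith [abs_nonneg q]
  obtain ⟨l, hl⟩ : ∃ l, l = -p / (2 * (|q| - p)) := ⟨_, rfl⟩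
  have hl' : l * (|q| - p) = -p / 2 := by
    rw [hl]
    field_simp
  have hl0 : 0 < l := by
    rw [hl]
    apply div_pos <;> linarith
  have hl1 : l < 1 := by
    rw [hl, div_lt_one (by linarith)]
    linarith [abs_nonneg q]
  have hr : (1 - l) * p + l * q < 0 := by
    nlinarith [mul_le_mul_of_nonneg_left (le_abs_self q) hl0.le]
  set r := (1 - l) * p + l * q with hrdef
  set w := (1 - l) * u + l * v with hw
  refine ⟨l, ⟨hl0, hl1⟩, (|w| + 1) / (-r), by
    apply div_nonneg <;> linarith [abs_nonneg w], ?_⟩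
  have h1 : (|w| + 1) / (-r) * r = -(|w| + 1) := by
    field_simp [hr.ne]
  have h2 : (1 - l) * (u + (|w| + 1) / (-r) * p) + l * (v + (|w| + 1) / (-r) * q)
      = w + (|w| + 1) / (-r) * r := by
    rw [hw, hrdef]
    ring
  rw [h2, h1]
  linarith [le_abs_self w]

theorem exists_weighted_combination_eq_zero {p q' : ℝ} (hp : p < 0) (hq' : 0 < q')
    (q p' u v : ℝ) :
    ∃ l ∈ Ioo (0 : ℝ) 1, ∃ b c : ℝ, 0 ≤ b ∧ 0 ≤ c ∧
      (1 - l) * (u + b * p + c * p') + l * (v + b * q + c * q') = 0 := by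
  obtain ⟨l₀, ⟨h0, h0'⟩, b, hb, hneg⟩ := exists_weighted_combination_neg hp q u v
  obtain ⟨l₁, ⟨h1, h1'⟩, c, hc, hpos⟩ :=
    exists_weighted_combination_neg (neg_lt_zero.2 hq') (-p') (-v) (-u)
  let L : ℝ → ℝ := fun t => (1 - t) * l₀ + t * (1 - l₁)
  let G : ℝ → ℝ := fun t => (1 - L t) * (u + (1 - t) * b * p + t * c * p') +
    L t * (v + (1 - t) * b * q + t * c * q')
  have hG : Continuous G := by fun_prop
  have hG0 : G 0 ≤ 0 := by
    simp only [G, L]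
    linarith
  have hG1 : 0 ≤ G 1 := by
    simp only [G, L]
    linarith
  obtain ⟨t, ⟨ht0, ht1⟩, ht⟩ :=
    intermediate_value_Icc (zero_le_one' ℝ) hG.continuousOn ⟨hG0, hG1⟩
  refine ⟨L t, ?_, (1 - t) * b, t * c, mul_nonneg (by linarith) hb, mul_nonneg ht0 hc, ht⟩
  exact convex_Ioo (0 : ℝ) 1 ⟨h0, h0'⟩ ⟨by linarith, by linarith⟩ (by linarith) ht0 (by ring)

theorem setIntegral_pos_superlevel {Ω : Type*} [MeasurableSpace Ω] {μ : Measure Ω} {f : Ω → ℝ}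
    (hf : Measurable f) (hi : Integrable f μ) (hμ : μ {ω | 0 < f ω} ≠ 0) :
    0 < ∫ ω in {ω | 0 < f ω}, f ω ∂μ := by
  have hm : MeasurableSet {ω | 0 < f ω} := measurableSet_lt measurable_const hf
  rw [setIntegral_pos_iff_support_of_nonneg_ae _ hi.integrableOn]
  · rw [inter_eq_right.2]
    · exact pos_iff_ne_zero.2 hμ
    · intro ω hω
      exact ne_of_gt hω
  · filter_upwards [ae_restrict_mem hm] with ω hω using le_of_lt hω

theorem ConvexMeasureSet.exists_dominating {Ω : Type*} [MeasurableSpace Ω]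
    {𝒬 : Set (Measure Ω)} (h : ConvexMeasureSet 𝒬) {P Q : Measure Ω} (hP : P ∈ 𝒬) (hQ : Q ∈ 𝒬) :
    ∃ R ∈ 𝒬, P ≪ R ∧ Q ≪ R := by
  refine ⟨_, h P hP Q hQ 2⁻¹ 2⁻¹ ENNReal.inv_two_add_inv_two, ?_, ?_⟩
  · exact (Measure.absolutelyContinuous_smul (by simp)).add_right _
  · rw [add_comm]
    exact (Measure.absolutelyContinuous_smul (by simp)).add_right _

theorem exists_measure_preimage_ne_zero {Ω : Type*} [MeasurableSpace Ω] {𝒬 : Set (Measure Ω)}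
    (hprob : ∀ P ∈ 𝒬, IsProbabilityMeasure P) {f : Ω → ℝ} {x : ℝ}
    (hx : x ∈ rvSupport 𝒬 f) {U : Set ℝ} (hU : IsOpen U) (hxU : x ∈ U) :
    ∃ P ∈ 𝒬, P (f ⁻¹' U) ≠ 0 := by
  by_contra! h
  refine hx Uᶜ ⟨hU.isClosed_compl, fun P hP => ?_⟩ hxU
  have := hprob P hP
  have h1 : f ⁻¹' Uᶜ =ᵐ[P] univ := by
    rw [ae_eq_univ, preimage_compl, compl_compl]
    exact h P hP
  rw [measure_congr h1, measure_univ]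

/-- Every finite measure is equivalent to a finite measure under which a given measurable function
is integrable. -/
theorem exists_equivalent_integrable {Ω : Type*} [MeasurableSpace Ω] (ν : Measure Ω)
    [IsFiniteMeasure ν] {g : Ω → ℝ} (hg : Measurable g) :
    ∃ μ : Measure Ω, IsFiniteMeasure μ ∧ ν ≪ μ ∧ μ ≪ ν ∧ Integrable g μ := by
  let d : Ω → NNReal := fun ω => (1 + ‖g ω‖₊)⁻¹
  have hd : Measurable d := by fun_prop
  have hd0 : ∀ ω, d ω ≠ 0 := fun ω => inv_ne_zero (by positivity)
  have hd1 : ∀ ω, d ω ≤ 1 := fun ω => inv_le_one_of_one_le₀ (by simp)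
  refine ⟨ν.withDensity fun ω => d ω, ?_, ?_, withDensity_absolutelyContinuous _ _, ?_⟩
  · refine isFiniteMeasure_withDensity (ne_top_of_le_ne_top (measure_ne_top ν univ) ?_)
    calc ∫⁻ ω, (d ω : ℝ≥0∞) ∂ν ≤ ∫⁻ _, (1 : ℝ≥0∞) ∂ν :=
          lintegral_mono fun ω => ENNReal.coe_le_one_iff.2 (hd1 ω)
      _ = ν univ := by simp
  · exact withDensity_absolutelyContinuous' hd.coe_nnreal_ennreal.aemeasurable
      (Filter.Eventually.of_forall fun ω => by exact_mod_cast hd0 ω)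
  · rw [integrable_withDensity_iff_integrable_smul hd]
    refine Integrable.of_bound (by fun_prop) 1 (Filter.Eventually.of_forall fun ω => ?_)
    have : d ω * ‖g ω‖₊ ≤ 1 := by
      simp only [d]
      rw [inv_mul_le_iff₀ (by positivity)]
      simp
    rw [NNReal.smul_def, norm_smul]
    simpa using (by exact_mod_cast this : (d ω : ℝ) * ‖g ω‖ ≤ 1)

/-- Remark 3.5. For every `s` strictly between `inf supp_𝒬 S̲₁` and
`sup supp_𝒬 S̄₁` (expressed robustly via points of the supports) and every `P ∈ 𝒬`, there exist
`Q ∈ Θ_P` and `λ ∈ (0,1)` with `E^Q[(1-λ) S̲₁ + λ S̄₁] = s`. -/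
theorem one_period_pair_to_CPS {Ω : Type*} [MeasurableSpace Ω]
    (𝒬 : Set (Measure Ω)) (hne : 𝒬.Nonempty)
    (hprob : ∀ P ∈ 𝒬, IsProbabilityMeasure P) (hconv : ConvexMeasureSet 𝒬)
    (Sb1 Sa1 : Ω → ℝ) (hSb1 : Measurable Sb1) (hSa1 : Measurable Sa1)
    (s : ℝ)
    (hlow : ∃ x ∈ rvSupport 𝒬 Sb1, x < s) (hhigh : ∃ y ∈ rvSupport 𝒬 Sa1, s < y) :
    ∀ P ∈ 𝒬, ∃ (Q : Measure Ω) (lam : ℝ),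
      Q ∈ Theta 𝒬 (fun ω => |Sa1 ω| + |Sb1 ω|) P ∧ lam ∈ Ioo (0 : ℝ) 1 ∧
      (∫ ω, ((1 - lam) * Sb1 ω + lam * Sa1 ω) ∂Q) = s := by
  intro P hP
  obtain ⟨x, hx, hxs⟩ := hlow
  obtain ⟨y, hy, hys⟩ := hhigh
  obtain ⟨P₁, hP₁, hA₁⟩ := exists_measure_preimage_ne_zero hprob hx isOpen_Iio hxs
  obtain ⟨P₂, hP₂, hB₂⟩ := exists_measure_preimage_ne_zero hprob hy isOpen_Ioi hys
  obtain ⟨P₃, hP₃, h₁₃, h₂₃⟩ := hconv.exists_dominating hP₁ hP₂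
  obtain ⟨R, hR, hPR, h₃R⟩ := hconv.exists_dominating hP hP₃
  have := hprob P hP
  have := hprob R hR
  obtain ⟨μ, hμ, hRμ, hμR, hint⟩ := exists_equivalent_integrable R
    (g := fun ω => |Sa1 ω| + |Sb1 ω|) (by fun_prop)
  have hb : Integrable (fun ω => Sb1 ω - s) μ :=
    (hint.mono hSb1.aestronglyMeasurable (Filter.Eventually.of_forall fun ω => by
      simp only [Real.norm_eq_abs]
      exact (le_add_of_nonneg_left (abs_nonneg _)).trans (le_abs_self _))).sub
      (integrable_const s)
  have ha : Integrable (fun ω => Sa1 ω - s) μ :=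
    (hint.mono hSa1.aestronglyMeasurable (Filter.Eventually.of_forall fun ω => by
      simp only [Real.norm_eq_abs]
      exact (le_add_of_nonneg_right (abs_nonneg _)).trans (le_abs_self _))).sub
      (integrable_const s)
  let A : Set Ω := {ω | 0 < s - Sb1 ω}
  let B : Set Ω := {ω | 0 < Sa1 ω - s}
  have hA : μ A ≠ 0 := fun h => hA₁ <| by
    have hz := h₁₃ (h₃R (hRμ h))
    simpa [A, preimage, Iio] using hz
  have hB : μ B ≠ 0 := fun h => hB₂ <| by
    have hz := h₂₃ (h₃R (hRμ h))
    simpa [B, preimage, Ioi] using hz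
  have hα : ∫ ω in A, (Sb1 ω - s) ∂μ < 0 := by
    have h := setIntegral_pos_superlevel (μ := μ) (f := fun ω => s - Sb1 ω) (by fun_prop)
      (hb.neg.congr (Filter.Eventually.of_forall fun ω => neg_sub (Sb1 ω) s)) hA
    rw [← neg_pos, ← integral_neg]
    simpa [A] using h
  have hβ : 0 < ∫ ω in B, (Sa1 ω - s) ∂μ :=
    setIntegral_pos_superlevel (by fun_prop) ha hB
  obtain ⟨l, hl, b, c, hb0, hc0, heq⟩ := exists_weighted_combination_eq_zero hα hβ
    (∫ ω in A, (Sa1 ω - s) ∂μ) (∫ ω in B, (Sb1 ω - s) ∂μ)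
    (∫ ω, (Sb1 ω - s) ∂μ) (∫ ω, (Sa1 ω - s) ∂μ)
  lift b to NNReal using hb0
  lift c to NNReal using hc0
  let m : Measure Ω := μ + b • μ.restrict A + c • μ.restrict B
  have hint_m : ∀ {f : Ω → ℝ}, Integrable f μ → Integrable f m := fun hf =>
    (hf.add_measure (hf.restrict.smul_measure_nnreal)).add_measure
      hf.restrict.smul_measure_nnreal
  have hval : ∀ {f : Ω → ℝ}, Integrable f μ →
      ∫ ω, f ω ∂m = ∫ ω, f ω ∂μ + b * ∫ ω in A, f ω ∂μ + c * ∫ ω in B, f ω ∂μ := by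
    intro f hf
    rw [integral_add_measure (hf.add_measure (hf.restrict.smul_measure_nnreal))
      hf.restrict.smul_measure_nnreal, integral_add_measure hf hf.restrict.smul_measure_nnreal,
      integral_smul_nnreal_measure, integral_smul_nnreal_measure]
    simp [NNReal.smul_def]
  have hμm : μ ≪ m := (Measure.AbsolutelyContinuous.rfl.add_right _).add_right _
  have hmμ : m ≪ μ := by
    refine Measure.AbsolutelyContinuous.add_left (Measure.AbsolutelyContinuous.add_left
      Measure.AbsolutelyContinuous.rfl ?_) ?_
    · exact Measure.restrict_le_self.absolutelyContinuous.smul_left b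
    · exact Measure.restrict_le_self.absolutelyContinuous.smul_left c
  have hPm : P ≪ m := hPR.trans (hRμ.trans hμm)
  have hm0 : NeZero m := ⟨fun h => by
    have : P univ = 0 := hPm (by simp [h])
    simp at this⟩
  have hm_inv : (m univ)⁻¹ ≠ 0 := ENNReal.inv_ne_zero.2 (measure_ne_top m univ)
  have hm_inv' : (m univ)⁻¹ ≠ ∞ := ENNReal.inv_ne_top.2 (NeZero.ne _)
  have hQ : IsProbabilityMeasure ((m univ)⁻¹ • m) := isProbabilityMeasureSMul
  refine ⟨(m univ)⁻¹ • m, l, ⟨hQ, hPm.trans (Measure.absolutelyContinuous_smul hm_inv),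
    ⟨R, hR, (Measure.smul_absolutelyContinuous).trans (hmμ.trans hμR)⟩,
    (hint_m hint).smul_measure hm_inv'⟩, hl, ?_⟩
  have hb' := (hint_m hb).const_mul (1 - l)
  have ha' := (hint_m ha).const_mul l
  have hzero : ∫ ω, ((1 - l) * (Sb1 ω - s) + l * (Sa1 ω - s)) ∂((m univ)⁻¹ • m) = 0 := by
    rw [integral_smul_measure, integral_add hb' ha', integral_const_mul, integral_const_mul,
      hval hb, hval ha, heq, smul_zero]
  calc ∫ ω, ((1 - l) * Sb1 ω + l * Sa1 ω) ∂((m univ)⁻¹ • m)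
      = ∫ ω, (((1 - l) * (Sb1 ω - s) + l * (Sa1 ω - s)) + s) ∂((m univ)⁻¹ • m) := by
        congr with ω
        ring
    _ = s := by
        have hsum : Integrable (fun ω => (1 - l) * (Sb1 ω - s) + l * (Sa1 ω - s))
            ((m univ)⁻¹ • m) := (hb'.add ha').smul_measure hm_inv'
        rw [integral_add hsum (integrable_const s), hzero]
        simp
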